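/- Let n ≥ 3 and let G be a closed subgroup of SU_n whose identity component G^c equals SU_{n−1} embedded in SU_n in the standard way, and let m be the number of connected components of G. Then G = G_{1,m}·SU_{n−1}, where G_{1,m} is the group of all block-diagonal matrices diag(α, β·id_{n−1}) with α^m = 1 and α·β^{n−1} = 1. -/

import Mathlib

open Matrix

noncomputable section

/-- The unitary group `U_n`. -/
abbrev UGrp (n : ℕ) := Matrix.unitaryGroup (Fin n) ℂ

/-- The special unitary group `SU_n`, as a subgroup of `U_n`. -/
def SUSub (n : ℕ) : Subgroup (UGrp n) where
  carrier := {A | (A : Matrix (Fin n) (Fin n) ℂ).det = 1}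
  one_mem' := by simp
  mul_mem' := by
    intro A B hA hB
    simp only [Set.mem_setOf_eq] at hA hB ⊢
    rw [MulMemClass.coe_mul, Matrix.det_mul, hA, hB, mul_one]
  inv_mem' := by
    intro A hA
    simp only [Set.mem_setOf_eq] at hA ⊢
    have h : ((A⁻¹ : UGrp n) : Matrix (Fin n) (Fin n) ℂ) * (A : Matrix (Fin n) (Fin n) ℂ)
        = 1 := by
      rw [← MulMemClass.coe_mul, inv_mul_cancel, OneMemClass.coe_one]
    have h2 := congrArg Matrix.det h
    rwa [Matrix.det_mul, hA, mul_one, Matrix.det_one] at h2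

/-- The standardly embedded copy of `SU_{n-1}` inside `SU_n`, as a subset: block-diagonal
matrices `diag(1, B)`; since the determinant is `1`, automatically `B ∈ SU_{n-1}`. -/
def stdSUSet (n : ℕ) [NeZero n] : Set (SUSub n) :=
  {A | ((A : UGrp n) : Matrix (Fin n) (Fin n) ℂ) 0 0 = 1 ∧
       ∀ j : Fin n, j ≠ 0 → ((A : UGrp n) : Matrix (Fin n) (Fin n) ℂ) 0 j = 0 ∧
         ((A : UGrp n) : Matrix (Fin n) (Fin n) ℂ) j 0 = 0}

theorem Circle.finite_of_isClosed_of_ne_top (H : Subgroup Circle) (hH : IsClosed (H : Set Circle))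
    (hne : H ≠ ⊤) : Finite H := by
  let S : AddSubgroup ℝ :=
    { carrier := {t | Circle.exp t ∈ H}
      zero_mem' := by simp
      add_mem' := fun {a b} ha hb => by
        simp only [Set.mem_ofPred_eq, Circle.exp_add] at *
        exact H.mul_mem ha hb
      neg_mem' := fun {a} ha => by
        simp only [Set.mem_ofPred_eq, Circle.exp_neg] at *
        exact H.inv_mem ha }
  have hmem : ∀ t, t ∈ S ↔ Circle.exp t ∈ H := fun t => Iff.rfl
  have hS : IsClosed (S : Set ℝ) := hH.preimage Circle.exp.continuous
  have hsurj : ∀ z : Circle, ∃ t, Circle.exp t = z := fun z => ⟨_, Circle.exp_arg z⟩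
  rcases AddSubgroup.dense_or_cyclic S with hd | ⟨a, ha⟩
  · refine absurd ?_ hne
    rw [eq_top_iff]
    intro z _
    obtain ⟨t, rfl⟩ := hsurj z
    have : t ∈ (S : Set ℝ) := by rw [← hS.closure_eq, hd.closure_eq]; trivial
    exact this
  · have h2 : 2 * Real.pi ∈ S := by simp [hmem]
    rw [ha, AddSubgroup.mem_closure_singleton] at h2
    obtain ⟨k, hk⟩ := h2
    have hk0 : k ≠ 0 := by
      rintro rfl
      simp at hk
    have hpow : ∀ z ∈ H, z ^ k.natAbs = 1 := by
      intro z hz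
      obtain ⟨t, rfl⟩ := hsurj z
      have ht : t ∈ S := hz
      rw [ha, AddSubgroup.mem_closure_singleton] at ht
      obtain ⟨j, rfl⟩ := ht
      rw [pow_natAbs_eq_one, ← Circle.exp_zsmul, smul_comm, hk, Circle.exp_zsmul,
        Circle.exp_two_pi, _root_.one_zpow]
    have hfin : (Polynomial.nthRootsFinset k.natAbs (1 : ℂ) : Set ℂ).Finite := Finset.finite_toSet _
    refine Set.Finite.subset (hfin.preimage (f := ((↑) : Circle → ℂ))
      Circle.coe_injective.injOn) (fun z hz => ?_) |>.to_subtype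
    rw [Set.mem_preimage, Finset.mem_coe, Polynomial.mem_nthRootsFinset (Int.natAbs_pos.mpr hk0)]
    exact congrArg ((↑) : Circle → ℂ) (hpow z hz)

theorem Circle.exists_mem_coe_eq_iff_pow_card_eq_one (H : Subgroup Circle) [Finite H] (z : ℂ) :
    (∃ w ∈ H, (w : ℂ) = z) ↔ z ^ Nat.card H = 1 := by
  have hpos : 0 < Nat.card H := Nat.card_pos
  have hsub : (fun w : Circle => (w : ℂ)) '' (H : Set Circle) ⊆
      Polynomial.nthRootsFinset (Nat.card H) (1 : ℂ) := by
    rintro _ ⟨w, hw, rfl⟩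
    rw [Finset.mem_coe, Polynomial.mem_nthRootsFinset hpos]
    have h := congrArg Subtype.val (pow_card_eq_one' (x := (⟨w, hw⟩ : H)))
    exact congrArg ((↑) : Circle → ℂ) h
  have heq := Set.eq_of_subset_of_ncard_le hsub (by
    rw [Set.ncard_image_of_injective (H : Set Circle) (f := fun w : Circle => (w : ℂ))
      Circle.coe_injective, Set.ncard_coe_finset]
    calc (Polynomial.nthRootsFinset (Nat.card H) (1 : ℂ)).card
        ≤ Multiset.card (Polynomial.nthRoots (Nat.card H) (1 : ℂ)) := by
          classical
          rw [Polynomial.nthRootsFinset_def]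
          exact Multiset.toFinset_card_le _
      _ ≤ Nat.card H := Polynomial.card_nthRoots _ _)
  rw [← Polynomial.mem_nthRootsFinset hpos, ← Finset.mem_coe, ← heq]
  rfl

section
variable {G : Type*} [Group G] [TopologicalSpace G] [IsTopologicalGroup G]

theorem mem_connectedComponent_iff_inv_mul_mem (x y : G) :
    y ∈ connectedComponent x ↔ x⁻¹ * y ∈ connectedComponent (1 : G) := by
  constructor <;> intro h
  · simpa using (continuous_const_mul x⁻¹).mapsTo_connectedComponent x h
  · simpa using (continuous_const_mul x).mapsTo_connectedComponent 1 h

variable (φ : G →* Circle)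

theorem mem_connectedComponent_iff_map_eq (hker : connectedComponent (1 : G) = φ.ker) (x y : G) :
    y ∈ connectedComponent x ↔ φ y = φ x := by
  rw [mem_connectedComponent_iff_inv_mul_mem, hker, SetLike.mem_coe, MonoidHom.mem_ker, map_mul,
    map_inv, inv_mul_eq_one, eq_comm]

theorem card_connectedComponents_eq_card_range (hker : connectedComponent (1 : G) = φ.ker) :
    Nat.card (ConnectedComponents G) = Nat.card φ.range := by
  refine Nat.card_congr ((Quotient.congr (ra := connectedComponentSetoid G)
    (rb := Setoid.ker φ) (Equiv.refl G) fun x y => ?_).trans (Setoid.quotientKerEquivRange φ))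
  change connectedComponent x = connectedComponent y ↔ φ x = φ y
  rw [eq_comm (a := φ x), ← mem_connectedComponent_iff_map_eq φ hker]
  exact ⟨fun h => h ▸ mem_connectedComponent,
    fun h => connectedComponent_eq h⟩

theorem range_ne_top_of_connectedComponent_eq_ker [CompactSpace G] (hφ : Continuous φ)
    (hker : connectedComponent (1 : G) = φ.ker) : φ.range ≠ ⊤ := by
  intro htop
  have hsurj := MonoidHom.range_eq_top.mp htop
  have hq : Topology.IsQuotientMap φ := hφ.isClosedMap.isQuotientMap hφ hsurj
  have hpre := hq.isCoinducing.preimage_connectedComponent (fun z => by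
    obtain ⟨x, rfl⟩ := hsurj z
    convert isConnected_connectedComponent (x := x) using 1
    exact Set.ext fun y => (mem_connectedComponent_iff_map_eq φ hker x y).symm) 1
  rw [PreconnectedSpace.connectedComponent_eq_univ, Set.preimage_univ, hker] at hpre
  obtain ⟨x, hx⟩ := hsurj (Circle.exp Real.pi)
  have hxk : x ∈ (φ.ker : Set G) := hpre ▸ Set.mem_univ x
  rw [SetLike.mem_coe, MonoidHom.mem_ker, hx] at hxk
  have := congrArg ((↑) : Circle → ℂ) hxk
  norm_num [Circle.coe_exp] at this

theorem coe_mem_range_iff_pow_card_connectedComponents [CompactSpace G] (hφ : Continuous φ)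
    (hker : connectedComponent (1 : G) = φ.ker) (z : ℂ) :
    (∃ g, (φ g : ℂ) = z) ↔ z ^ Nat.card (ConnectedComponents G) = 1 := by
  have : Finite φ.range := Circle.finite_of_isClosed_of_ne_top φ.range
    (by simpa using (isCompact_range hφ).isClosed)
    (range_ne_top_of_connectedComponent_eq_ker φ hφ hker)
  rw [card_connectedComponents_eq_card_range φ hker, ← Circle.exists_mem_coe_eq_iff_pow_card_eq_one]
  simp
end

instance compactSpace_unitaryGroup (n : ℕ) : CompactSpace (UGrp n) := by
  have hK : IsCompact (Set.univ.pi fun _ : Fin n => Set.univ.pi fun _ : Fin n =>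
      Metric.closedBall (0 : ℂ) 1) :=
    isCompact_univ_pi fun _ => isCompact_univ_pi fun _ => isCompact_closedBall _ _
  refine isCompact_iff_compactSpace.mp
    (hK.of_isClosed_subset (isClosed_unitary (R := Matrix (Fin n) (Fin n) ℂ)) fun U hU i _ j _ => ?_)
  simpa using entry_norm_bound_of_unitary hU i j

theorem isClosed_SUSub (n : ℕ) : IsClosed (SUSub n : Set (UGrp n)) :=
  isClosed_singleton.preimage (Continuous.matrix_det continuous_subtype_val)

section
variable {n : ℕ}

theorem SUSub.coe_inv (A : SUSub n) : (A⁻¹).1.1 = star A.1.1 := rfl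

theorem SUSub.coe_mul (A B : SUSub n) : (A * B).1.1 = A.1.1 * B.1.1 := rfl

theorem SUSub.exists_coe_eq_diagonal (d : Fin n → ℂ) (hd : ∀ i, ‖d i‖ = 1)
    (hdet : ∏ i, d i = 1) : ∃ D : SUSub n, D.1.1 = Matrix.diagonal d := by
  refine ⟨⟨⟨Matrix.diagonal d, ?_⟩, ?_⟩, rfl⟩
  · rw [Matrix.mem_unitaryGroup_iff, Matrix.star_eq_conjTranspose, Matrix.diagonal_conjTranspose,
      Matrix.diagonal_mul_diagonal, ← Matrix.diagonal_one]
    congr 1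
    ext i
    simp [Complex.mul_conj, Complex.normSq_eq_norm_sq, hd]
  · change (Matrix.diagonal d).det = 1
    rw [Matrix.det_diagonal, hdet]

variable [NeZero n]

/-- A matrix is block diagonal of shape `diag(a, B)` with `a` of size one. -/
def IsBlockDiagonal (M : Matrix (Fin n) (Fin n) ℂ) : Prop :=
  ∀ j : Fin n, j ≠ 0 → M 0 j = 0 ∧ M j 0 = 0

theorem IsBlockDiagonal.mul_apply_zero_zero {M N : Matrix (Fin n) (Fin n) ℂ}
    (hM : IsBlockDiagonal M) : (M * N) 0 0 = M 0 0 * N 0 0 := by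
  rw [Matrix.mul_apply, Finset.sum_eq_single 0] <;> simp +contextual [(hM _ _).1]

theorem IsBlockDiagonal.mul {M N : Matrix (Fin n) (Fin n) ℂ}
    (hM : IsBlockDiagonal M) (hN : IsBlockDiagonal N) : IsBlockDiagonal (M * N) := by
  intro j hj
  constructor <;> rw [Matrix.mul_apply, Finset.sum_eq_zero] <;> intro i _ <;>
    rcases eq_or_ne i 0 with rfl | hi
  · rw [(hN j hj).1, mul_zero]
  · rw [(hM i hi).1, zero_mul]
  · rw [(hM j hj).2, zero_mul]
  · rw [(hN i hi).2, mul_zero]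

theorem IsBlockDiagonal.star {M : Matrix (Fin n) (Fin n) ℂ} (hM : IsBlockDiagonal M) :
    IsBlockDiagonal (star M) := fun j hj => by
  simp [Matrix.star_apply, hM j hj]

theorem isBlockDiagonal_diagonal (d : Fin n → ℂ) : IsBlockDiagonal (Matrix.diagonal d) :=
  fun j hj => by simp [hj, hj.symm]

theorem mem_stdSUSet_iff (A : SUSub n) :
    A ∈ stdSUSet n ↔ A.1.1 0 0 = 1 ∧ IsBlockDiagonal A.1.1 := Iff.rfl

theorem IsBlockDiagonal.norm_apply_zero_zero {A : SUSub n} (hA : IsBlockDiagonal A.1.1) :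
    ‖A.1.1 0 0‖ = 1 := by
  have h := congrFun (congrFun (Matrix.UnitaryGroup.star_mul_self (A : UGrp n)) 0) 0
  rw [IsBlockDiagonal.mul_apply_zero_zero hA.star, Matrix.star_apply, Matrix.one_apply_eq,
    Complex.star_def, mul_comm, Complex.mul_conj, Complex.normSq_eq_norm_sq] at h
  have h2 : ‖A.1.1 0 0‖ ^ 2 = 1 := by exact_mod_cast h
  exact (pow_eq_one_iff_of_nonneg (norm_nonneg _) two_ne_zero).mp h2

theorem inv_mul_mem_stdSUSet {A B : SUSub n} (hA : IsBlockDiagonal A.1.1)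
    (hB : IsBlockDiagonal B.1.1) (h : A.1.1 0 0 = B.1.1 0 0) :
    A⁻¹ * B ∈ stdSUSet n := by
  rw [mem_stdSUSet_iff, SUSub.coe_mul, SUSub.coe_inv]
  refine ⟨?_, hA.star.mul hB⟩
  rw [hA.star.mul_apply_zero_zero, ← h, Matrix.star_apply, Complex.star_def, mul_comm,
    Complex.mul_conj, Complex.normSq_eq_norm_sq, hA.norm_apply_zero_zero]
  simp

theorem apply_zero_eq_zero_of_conj_mem_stdSUSet (hn : 3 ≤ n) {A : SUSub n}
    (hA : ∀ B ∈ stdSUSet n, A⁻¹ * B * A ∈ stdSUSet n) {j : Fin n} (hj : j ≠ 0) :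
    A.1.1 j 0 = 0 := by
  obtain ⟨k, hk⟩ : ∃ k : Fin n, k ∉ ({0, j} : Finset (Fin n)) := by
    by_contra! hall
    have := (Finset.card_le_card fun k _ => hall k : (Finset.univ : Finset (Fin n)).card ≤ _)
    have := Finset.card_le_two (a := (0 : Fin n)) (b := j)
    simp at *
    omega
  obtain ⟨hk0, hkj⟩ : k ≠ 0 ∧ k ≠ j := by simpa using hk
  obtain ⟨D, hD⟩ := SUSub.exists_coe_eq_diagonal
    (fun i : Fin n => (if i = j then (-1 : ℂ) else 1) * (if i = k then -1 else 1))
    (fun i => by split_ifs <;> simp) (by rw [Finset.prod_mul_distrib]; simp)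
  have hDmem : D ∈ stdSUSet n := by
    rw [mem_stdSUSet_iff, hD]
    exact ⟨by simp [hj.symm, hk0.symm], isBlockDiagonal_diagonal _⟩
  obtain ⟨h1, h2⟩ := hA D hDmem
  have hmul : D.1.1 * A.1.1 = A.1.1 * (A⁻¹ * D * A).1.1 := by
    rw [← SUSub.coe_mul, ← SUSub.coe_mul]
    congr 2
    group
  have h := congrFun (congrFun hmul j) 0
  rw [hD, Matrix.diagonal_mul, Matrix.mul_apply, Finset.sum_eq_single 0] at h
  · rw [h1] at h
    simp only [if_true, hkj.symm, if_false] at h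
    linear_combination (-1 / 2 : ℂ) * h
  · intro i _ hi
    rw [(h2 i hi).2, mul_zero]
  · simp

theorem isBlockDiagonal_of_conj_mem_stdSUSet (hn : 3 ≤ n) {A : SUSub n}
    (hA : ∀ B ∈ stdSUSet n, A⁻¹ * B * A ∈ stdSUSet n)
    (hA' : ∀ B ∈ stdSUSet n, A * B * A⁻¹ ∈ stdSUSet n) : IsBlockDiagonal A.1.1 := by
  refine fun j hj => ⟨?_, apply_zero_eq_zero_of_conj_mem_stdSUSet hn hA hj⟩
  have h := apply_zero_eq_zero_of_conj_mem_stdSUSet hn (A := A⁻¹) (by simpa using hA') hj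
  rwa [SUSub.coe_inv, Matrix.star_apply, star_eq_zero] at h

theorem conj_mem_of_image_connectedComponent_eq {Γ : Type*} [Group Γ] [TopologicalSpace Γ]
    [IsTopologicalGroup Γ] {G : Subgroup Γ} {K : Set Γ}
    (hK : Subtype.val '' connectedComponent (1 : G) = K) {g k : Γ} (hg : g ∈ G) (hk : k ∈ K) :
    g * k * g⁻¹ ∈ K := by
  subst hK
  obtain ⟨k, hk, rfl⟩ := hk
  refine ⟨⟨g, hg⟩ * k * ⟨g, hg⟩⁻¹, ?_, rfl⟩
  have hc : Continuous fun x : G => (⟨g, hg⟩ : G) * x * ⟨g, hg⟩⁻¹ := by fun_prop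
  simpa using hc.mapsTo_connectedComponent 1 hk

/-- The upper left entry, as a character of a group of block diagonal matrices. -/
def upperLeftHom (G : Subgroup (SUSub n)) (hG : ∀ g ∈ G, IsBlockDiagonal g.1.1) :
    G →* Circle :=
  MonoidHom.mk' (fun g => ⟨g.1.1.1 0 0,
      mem_sphere_zero_iff_norm.mpr (hG g g.2).norm_apply_zero_zero⟩)
    fun g _ => Subtype.ext (hG g g.2).mul_apply_zero_zero

theorem coe_upperLeftHom (G : Subgroup (SUSub n)) (hG : ∀ g ∈ G, IsBlockDiagonal g.1.1)
    (g : G) : (upperLeftHom G hG g : ℂ) = g.1.1.1 0 0 := rfl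

theorem continuous_upperLeftHom (G : Subgroup (SUSub n))
    (hG : ∀ g ∈ G, IsBlockDiagonal g.1.1) : Continuous (upperLeftHom G hG) := by
  have h : Continuous fun g : G => g.1.1.1 :=
    continuous_subtype_val.comp (continuous_subtype_val.comp continuous_subtype_val)
  exact Continuous.subtype_mk (h.matrix_elem 0 0) _

theorem prod_ite_eq_zero (α β : ℂ) :
    ∏ i : Fin n, (if i = 0 then α else β) = α * β ^ (n - 1) := by
  rw [← Finset.mul_prod_erase _ _ (Finset.mem_univ 0), if_pos rfl]
  congr 1
  rw [Finset.prod_congr rfl fun i hi => if_neg (Finset.ne_of_mem_erase hi)]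
  simp

theorem IsBlockDiagonal.exists_eq_diagonal_mul (hn : 3 ≤ n) {A : SUSub n}
    (hA : IsBlockDiagonal A.1.1) :
    ∃ β : ℂ, A.1.1 0 0 * β ^ (n - 1) = 1 ∧ ∃ C ∈ stdSUSet n, A.1.1 =
      Matrix.diagonal (fun i : Fin n => if i = 0 then A.1.1 0 0 else β) * C.1.1 := by
  have hnorm := hA.norm_apply_zero_zero
  have hn1 : n - 1 ≠ 0 := by omega
  obtain ⟨β, hβ⟩ := IsAlgClosed.exists_pow_nat_eq (A.1.1 0 0)⁻¹ (Nat.pos_of_ne_zero hn1)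
  have hβn : ‖β‖ = 1 := (pow_eq_one_iff_of_nonneg (norm_nonneg β) hn1).mp (by
    rw [← norm_pow, hβ, norm_inv, hnorm, inv_one])
  have hprod : A.1.1 0 0 * β ^ (n - 1) = 1 := by
    rw [hβ, mul_inv_cancel₀]
    exact norm_ne_zero_iff.mp (by rw [hnorm]; exact one_ne_zero)
  obtain ⟨D, hD⟩ := SUSub.exists_coe_eq_diagonal
    (fun i : Fin n => if i = 0 then A.1.1 0 0 else β)
    (fun i => by split_ifs <;> assumption) (by rw [prod_ite_eq_zero, hprod])
  refine ⟨β, hprod, D⁻¹ * A, inv_mul_mem_stdSUSet ?_ hA ?_, ?_⟩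
  · rw [hD]
    exact isBlockDiagonal_diagonal _
  · simp [hD]
  · rw [← hD, ← SUSub.coe_mul, mul_inv_cancel_left]
end

/-- Let `n ≥ 3` and let `G` be a closed subgroup of `SU_n` whose identity
component equals `SU_{n−1}` standardly embedded in `SU_n`, and let `m` be the number of
connected components of `G`. Then `G = G_{1,m} · SU_{n−1}`, where `G_{1,m}` consists of all
block-diagonal matrices `diag(α, β·id_{n−1})` with `α^m = 1` and `α·β^{n−1} = 1`. -/
theorem components_of_closed_subgroup_with_su_identity_component
    {n : ℕ} (hn : 3 ≤ n) [NeZero n]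
    (G : Subgroup (SUSub n))
    (hclosed : IsClosed (G : Set (SUSub n)))
    (hcomp : (Subtype.val '' connectedComponent (1 : G)) = stdSUSet n)
    (m : ℕ) (hm : m = Nat.card (ConnectedComponents G)) :
    (G : Set (SUSub n)) =
      {A : SUSub n | ∃ α β : ℂ, α ^ m = 1 ∧ α * β ^ (n - 1) = 1 ∧
        ∃ C : SUSub n, C ∈ stdSUSet n ∧
          ((A : UGrp n) : Matrix (Fin n) (Fin n) ℂ) =
            Matrix.diagonal (fun i : Fin n => if i = 0 then α else β) *
              ((C : UGrp n) : Matrix (Fin n) (Fin n) ℂ)} := by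
  have hG : ∀ g ∈ G, IsBlockDiagonal g.1.1 := fun g hg =>
    isBlockDiagonal_of_conj_mem_stdSUSet hn
      (fun B hB => by
        simpa using conj_mem_of_image_connectedComponent_eq hcomp (G.inv_mem hg) hB)
      (fun B hB => conj_mem_of_image_connectedComponent_eq hcomp hg hB)
  have hKG : ∀ {k}, k ∈ stdSUSet n → k ∈ G := fun {k} hk => by
    rw [← hcomp] at hk
    obtain ⟨x, _, rfl⟩ := hk
    exact x.2
  have hker : connectedComponent (1 : G) = (upperLeftHom G hG).ker := by
    ext g
    rw [← Subtype.val_injective.mem_set_image, hcomp, mem_stdSUSet_iff, SetLike.mem_coe,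
      MonoidHom.mem_ker, ← Circle.coe_inj, coe_upperLeftHom, Circle.coe_one]
    exact and_iff_left (hG g g.2)
  have : CompactSpace (SUSub n) := isCompact_iff_compactSpace.mp (isClosed_SUSub n).isCompact
  have : CompactSpace G := isCompact_iff_compactSpace.mp hclosed.isCompact
  have hrange := coe_mem_range_iff_pow_card_connectedComponents (upperLeftHom G hG)
    (continuous_upperLeftHom G hG) hker
  rw [← hm] at hrange
  ext A
  constructor
  · intro hA
    obtain ⟨β, hβ, C, hC, h⟩ := (hG A hA).exists_eq_diagonal_mul hn
    exact ⟨_, β, (hrange _).mp ⟨⟨A, hA⟩, rfl⟩, hβ, C, hC, h⟩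
  · rintro ⟨α, β, hα, -, C, hC, hAC⟩
    obtain ⟨⟨g, hg⟩, rfl⟩ := (hrange α).mpr hα
    have hA : IsBlockDiagonal A.1.1 := hAC ▸ (isBlockDiagonal_diagonal _).mul hC.2
    have h00 : g.1.1 0 0 = A.1.1 0 0 := by
      rw [hAC, Matrix.diagonal_mul, hC.1, mul_one, if_pos rfl, coe_upperLeftHom]
    have := G.mul_mem hg (hKG (inv_mul_mem_stdSUSet (hG g hg) hA h00))
    rwa [mul_inv_cancel_left] at this

end
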